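/- arXiv:1510.03240 — 3 statements merged into one kernel-verified Lean document; each statement's English description precedes it below -/
import Mathlib

section
/- Let d ≥ 2 and let Δ be a nonzero traceless Hermitian matrix on C^d ⊗ C^d. Then there exist a classical-classical state ρ on C^d ⊗ C^d and a real number λ such that ρ + λΔ is a state but is not classical-classical. -/
open Matrix
open Kronecker
open scoped ComplexOrder

noncomputable section

/-- A state (density matrix): positive semidefinite with trace 1. -/
def IsState {n : Type*} [Fintype n] (ρ : Matrix n n ℂ) : Prop :=
  ρ.PosSemidef ∧ ρ.trace = 1

/-- A family of `d` vectors in `ℂ^d` forming an orthonormal basis. -/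
def IsONB {d : ℕ} (φ : Fin d → Fin d → ℂ) : Prop :=
  ∀ i j, star (φ i) ⬝ᵥ φ j = if i = j then 1 else 0

/-- Classical-quantum states: `ρ = ∑ᵢ cᵢ |φᵢ⟩⟨φᵢ| ⊗ ηᵢ` for an orthonormal basis `{φᵢ}`,
nonnegative `cᵢ` summing to `1`, and states `ηᵢ`. -/
def IsCQ {d : ℕ} (ρ : Matrix (Fin d × Fin d) (Fin d × Fin d) ℂ) : Prop :=
  ∃ (φ : Fin d → Fin d → ℂ) (c : Fin d → ℝ) (η : Fin d → Matrix (Fin d) (Fin d) ℂ),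
    IsONB φ ∧ (∀ i, 0 ≤ c i) ∧ ((∑ i, c i) = 1) ∧ (∀ i, IsState (η i)) ∧
    ρ = ∑ i, (c i : ℂ) • (vecMulVec (φ i) (star (φ i)) ⊗ₖ η i)

/-- Quantum-classical states: `ρ = ∑ᵢ cᵢ σᵢ ⊗ |χᵢ⟩⟨χᵢ|`. -/
def IsQC {d : ℕ} (ρ : Matrix (Fin d × Fin d) (Fin d × Fin d) ℂ) : Prop :=
  ∃ (χ : Fin d → Fin d → ℂ) (c : Fin d → ℝ) (σ : Fin d → Matrix (Fin d) (Fin d) ℂ),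
    IsONB χ ∧ (∀ i, 0 ≤ c i) ∧ ((∑ i, c i) = 1) ∧ (∀ i, IsState (σ i)) ∧
    ρ = ∑ i, (c i : ℂ) • (σ i ⊗ₖ vecMulVec (χ i) (star (χ i)))

/-- Classical-classical states: `ρ = ∑ᵢⱼ cᵢⱼ |φᵢ⟩⟨φᵢ| ⊗ |χⱼ⟩⟨χⱼ|`. -/
def IsCC {d : ℕ} (ρ : Matrix (Fin d × Fin d) (Fin d × Fin d) ℂ) : Prop :=
  ∃ (φ χ : Fin d → Fin d → ℂ) (c : Fin d → Fin d → ℝ),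
    IsONB φ ∧ IsONB χ ∧ (∀ i j, 0 ≤ c i j) ∧ ((∑ i, ∑ j, c i j) = 1) ∧
    ρ = ∑ i, ∑ j, (c i j : ℂ) • (vecMulVec (φ i) (star (φ i)) ⊗ₖ vecMulVec (χ j) (star (χ j)))

/-- The operator `⟨b| M |b'⟩` on the first tensor factor, for basis vectors of the second one. -/
def sndBlock {d : ℕ} (M : Matrix (Fin d × Fin d) (Fin d × Fin d) ℂ) (b b' : Fin d) :
    Matrix (Fin d) (Fin d) ℂ :=
  Matrix.of fun a a' => M (a, b) (a', b')

/-- All blocks of a classical-classical state are diagonal in the same basis, so they commute. -/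
lemma IsCC.commute_sndBlock {d : ℕ} {M : Matrix (Fin d × Fin d) (Fin d × Fin d) ℂ}
    (hM : IsCC M) (b b' c c' : Fin d) : Commute (sndBlock M b b') (sndBlock M c c') := by
  obtain ⟨φ, χ, w, hφ, -, -, -, rfl⟩ := hM
  have hblock : ∀ b b' : Fin d,
      sndBlock (∑ i, ∑ j, (w i j : ℂ) •
        (vecMulVec (φ i) (star (φ i)) ⊗ₖ vecMulVec (χ j) (star (χ j)))) b b' =
      ∑ i, (∑ j, (w i j : ℂ) * vecMulVec (χ j) (star (χ j)) b b') •
        vecMulVec (φ i) (star (φ i)) := by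
    intro b b'
    ext a a'
    simp only [sndBlock, Matrix.of_apply, Matrix.sum_apply, Matrix.smul_apply, kronecker_apply,
      smul_eq_mul, Finset.sum_mul]
    exact Finset.sum_congr rfl fun i _ => Finset.sum_congr rfl fun j _ => by ring
  rw [hblock, hblock]
  refine Commute.sum_left _ _ _ fun i _ => Commute.sum_right _ _ _ fun k _ => ?_
  refine Commute.smul_left (Commute.smul_right ?_ _) _
  by_cases h : i = k
  · subst h
    exact Commute.refl _
  · rw [Commute, SemiconjBy, vecMulVec_mul_vecMulVec, vecMulVec_mul_vecMulVec, hφ, hφ, if_neg h,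
      if_neg (Ne.symm h), zero_smul, zero_smul, vecMulVec_zero, vecMulVec_zero]

lemma IsCC.submatrix_swap {d : ℕ} {M : Matrix (Fin d × Fin d) (Fin d × Fin d) ℂ}
    (hM : IsCC M) : IsCC (M.submatrix Prod.swap Prod.swap) := by
  obtain ⟨φ, χ, w, hφ, hχ, hw, hsum, rfl⟩ := hM
  refine ⟨χ, φ, fun i j => w j i, hχ, hφ, fun i j => hw j i, ?_, ?_⟩
  · rw [Finset.sum_comm, hsum]
  · rw [Finset.sum_comm]
    ext ⟨a, b⟩ ⟨a', b'⟩
    simp only [Matrix.submatrix_apply, Matrix.sum_apply, Matrix.smul_apply, Prod.swap_prod_mk,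
      kronecker_apply, smul_eq_mul]
    exact Finset.sum_congr rfl fun i _ => Finset.sum_congr rfl fun j _ => by ring

lemma IsState.submatrix_swap {d : ℕ} {M : Matrix (Fin d × Fin d) (Fin d × Fin d) ℂ}
    (hM : IsState M) : IsState (M.submatrix Prod.swap Prod.swap) := by
  refine ⟨hM.1.submatrix _, ?_⟩
  rw [← hM.2]
  exact Equiv.sum_comp (Equiv.prodComm (Fin d) (Fin d)) fun i => M i i

/-- Completeness relation of an orthonormal basis. -/
lemma IsONB.sum_vecMulVec {d : ℕ} {φ : Fin d → Fin d → ℂ} (hφ : IsONB φ) :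
    ∑ i, vecMulVec (φ i) (star (φ i)) = 1 := by
  have h : (Matrix.of φ).map star * (Matrix.of φ)ᵀ = 1 := by
    ext i j
    rw [Matrix.one_apply, ← hφ i j]
    simp [Matrix.mul_apply, dotProduct]
  have h' := mul_eq_one_comm.mp h
  rw [← h']
  ext a b
  simp [Matrix.mul_apply, Matrix.sum_apply, vecMulVec_apply]

lemma isONB_single (d : ℕ) : IsONB fun i : Fin d => (Pi.single i 1 : Fin d → ℂ) := by
  intro i j
  simp [Pi.single_apply, eq_comm, dotProduct]

/-- Every unit vector is a member of some orthonormal basis. -/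
lemma exists_isONB {d : ℕ} (hd : 0 < d) (v : Fin d → ℂ) (hv : star v ⬝ᵥ v = 1) :
    ∃ (φ : Fin d → Fin d → ℂ) (i : Fin d), IsONB φ ∧ φ i = v := by
  have hinner : ∀ x y : EuclideanSpace ℂ (Fin d),
      star (x : Fin d → ℂ) ⬝ᵥ (y : Fin d → ℂ) = inner ℂ x y := by
    intro x y
    rw [EuclideanSpace.inner_eq_star_dotProduct, dotProduct_comm]
  let i₀ : Fin d := ⟨0, hd⟩
  have horth : Orthonormal ℂ
      (({i₀} : Set (Fin d)).domRestrict fun _ => (WithLp.toLp 2 v : EuclideanSpace ℂ (Fin d))) := by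
    rw [orthonormal_iff_ite]
    rintro ⟨i, hi⟩ ⟨j, hj⟩
    obtain rfl : i = i₀ := hi
    obtain rfl : j = i₀ := hj
    simpa only [Set.domRestrict_apply, ← hinner, if_true] using hv
  obtain ⟨b, hb⟩ := horth.exists_orthonormalBasis_extension_of_card_eq (by simp)
  refine ⟨fun i => b i, i₀, fun i j => ?_, ?_⟩
  · rw [hinner, orthonormal_iff_ite.mp b.orthonormal]
  · exact congrArg WithLp.ofLp (hb i₀ rfl)

section

open scoped MatrixOrder Matrix.Norms.L2Operator

/-- A Hermitian matrix is dominated in both directions by a multiple of the identity. -/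
lemma Matrix.IsHermitian.exists_posSemidef_smul_one_add_sub {n : Type*} [Fintype n]
    [DecidableEq n] {A : Matrix n n ℂ} (hA : A.IsHermitian) :
    ∃ N : ℝ, 0 ≤ N ∧ ((N : ℂ) • (1 : Matrix n n ℂ) + A).PosSemidef ∧
      ((N : ℂ) • (1 : Matrix n n ℂ) - A).PosSemidef := by
  have hsa : IsSelfAdjoint A := hA
  have hN : algebraMap ℝ (Matrix n n ℂ) ‖A‖ = ((‖A‖ : ℝ) : ℂ) • (1 : Matrix n n ℂ) := by
    rw [Algebra.algebraMap_eq_smul_one, Complex.coe_smul]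
  refine ⟨‖A‖, norm_nonneg _, ?_, ?_⟩
  · have h := Matrix.le_iff.mp hsa.neg_algebraMap_norm_le_self
    rwa [sub_neg_eq_add, hN, add_comm] at h
  · have h := Matrix.le_iff.mp hsa.le_algebraMap_norm_self
    rwa [hN] at h

end

/-- The normalized mixture of the identity with a pure product state is classical-classical. -/
lemma isCC_smul_one_add_kronecker {d : ℕ} {φ χ : Fin d → Fin d → ℂ} (hφ : IsONB φ)
    (hχ : IsONB χ) (k l : Fin d) {N t : ℝ} (hN : 0 ≤ N) (ht : 0 ≤ t)
    (htN : t * (N * d ^ 2 + 1) = 1) :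
    IsCC ((t : ℂ) • ((N : ℂ) • (1 : Matrix (Fin d × Fin d) (Fin d × Fin d) ℂ) +
      vecMulVec (φ k) (star (φ k)) ⊗ₖ vecMulVec (χ l) (star (χ l)))) := by
  refine ⟨φ, χ, fun i j => t * (N + if i = k then (if j = l then 1 else 0) else 0), hφ, hχ,
    fun i j => ?_, ?_, ?_⟩
  · refine mul_nonneg ht (add_nonneg hN ?_)
    split_ifs <;> norm_num
  · simp only [← Finset.mul_sum, Finset.sum_add_distrib]
    refine Eq.trans ?_ htN
    congr 2
    · simp
      ring
    · rw [Finset.sum_comm]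
      simp
  · have hone : (1 : Matrix (Fin d × Fin d) (Fin d × Fin d) ℂ) =
        ∑ i, ∑ j, vecMulVec (φ i) (star (φ i)) ⊗ₖ vecMulVec (χ j) (star (χ j)) := by
      rw [← one_kronecker_one]
      conv_lhs => enter [2]; rw [← hφ.sum_vecMulVec]
      conv_lhs => enter [3]; rw [← hχ.sum_vecMulVec]
      ext ⟨a, b⟩ ⟨a', b'⟩
      simp only [Matrix.sum_apply, kronecker_apply, Finset.sum_mul_sum]
    have hsingle : vecMulVec (φ k) (star (φ k)) ⊗ₖ vecMulVec (χ l) (star (χ l)) =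
        ∑ i, ∑ j, (if i = k then (if j = l then (1 : ℂ) else 0) else 0) •
          (vecMulVec (φ i) (star (φ i)) ⊗ₖ vecMulVec (χ j) (star (χ j))) := by
      rw [Finset.sum_eq_single k, Finset.sum_eq_single l]
      · simp
      · intro j _ hj
        simp [hj]
      · simp
      · intro i _ hi
        simp [hi]
      · simp
    conv_lhs => rw [hone, hsingle]
    simp only [Finset.smul_sum, ← Finset.sum_add_distrib]
    refine Finset.sum_congr rfl fun i _ => Finset.sum_congr rfl fun j _ => ?_
    rw [Complex.ofReal_mul, Complex.ofReal_add, mul_smul, add_smul]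
    split_ifs <;> simp

/-- A matrix commuting with all rank one projections is scalar. -/
lemma eq_scalar_of_commute_vecMulVec {d : ℕ} {G : Matrix (Fin d) (Fin d) ℂ}
    (hG : ∀ v : Fin d → ℂ, star v ⬝ᵥ v = 1 → Commute G (vecMulVec v (star v))) :
    (∀ a a', a ≠ a' → G a a' = 0) ∧ ∀ a a', G a a = G a' a' := by
  have hG' : ∀ v : Fin d → ℂ, Commute G (vecMulVec v (star v)) := by
    intro v
    by_cases hv : v = 0
    · simp [hv]
    have hpos : 0 < star v ⬝ᵥ v := dotProduct_star_self_pos_iff.mpr hv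
    obtain ⟨r, hr, hrv⟩ : ∃ r : ℝ, 0 < r ∧ star v ⬝ᵥ v = (r : ℂ) := by
      obtain ⟨h1, h2⟩ := Complex.lt_def.mp hpos
      exact ⟨(star v ⬝ᵥ v).re, h1, Complex.ext rfl (by simpa using h2.symm)⟩
    have hs : ((√r : ℝ) : ℂ) * (√r : ℝ) = r := by
      rw [← Complex.ofReal_mul, Real.mul_self_sqrt hr.le]
    have hs0 : ((√r : ℝ) : ℂ) ≠ 0 := by
      exact_mod_cast (Real.sqrt_pos.mpr hr).ne'
    have h := hG (((√r : ℝ) : ℂ)⁻¹ • v) (by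
      rw [star_smul, smul_dotProduct, dotProduct_smul, hrv, ← hs]
      simp
      field_simp)
    have hv' : vecMulVec v (star v) = (r : ℂ) •
        vecMulVec (((√r : ℝ) : ℂ)⁻¹ • v) (star (((√r : ℝ) : ℂ)⁻¹ • v)) := by
      ext a b
      simp [vecMulVec_apply, ← hs]
      field_simp
    rw [hv']
    exact h.smul_right _
  have hoff : ∀ a a', a ≠ a' → G a a' = 0 := by
    intro a a' haa'
    have h := congrFun (congrFun (hG' (Pi.single a' 1)).eq a) a'
    simpa [Matrix.mul_vecMulVec, Matrix.vecMulVec_mul, vecMulVec_apply, haa'] using h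
  refine ⟨hoff, fun a a' => ?_⟩
  by_cases haa' : a = a'
  · rw [haa']
  have h := congrFun (congrFun (hG' (Pi.single a 1 + Pi.single a' 1)).eq a) a'
  simpa [Matrix.mul_vecMulVec, Matrix.vecMulVec_mul, vecMulVec_apply, haa', Ne.symm haa',
    Matrix.mulVec_add, Matrix.add_vecMul, hoff a a' haa'] using h

/-- If adding multiples of `Δ` never leads from a classical-classical state to a state which is
not classical-classical, then every block of `Δ` is a scalar matrix. -/
lemma sndBlock_scalar_of_preserves_isCC {d : ℕ} (hd : 2 ≤ d)
    {Δ : Matrix (Fin d × Fin d) (Fin d × Fin d) ℂ} (hΔH : Δ.IsHermitian) (hΔtr : Δ.trace = 0)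
    (h : ∀ (ρ : Matrix (Fin d × Fin d) (Fin d × Fin d) ℂ) (lam : ℝ),
      IsCC ρ → IsState (ρ + (lam : ℂ) • Δ) → IsCC (ρ + (lam : ℂ) • Δ)) (b b' : Fin d) :
    (∀ a a', a ≠ a' → Δ (a, b) (a', b') = 0) ∧
      ∀ a a', Δ (a, b) (a, b') = Δ (a', b) (a', b') := by
  refine eq_scalar_of_commute_vecMulVec (G := sndBlock Δ b b') fun v hv => ?_
  obtain ⟨φ, k, hφ, rfl⟩ := exists_isONB (by omega) v hv
  have : Nontrivial (Fin d) := Fin.nontrivial_iff_two_le.mpr hd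
  obtain ⟨c, hc⟩ := exists_ne b
  obtain ⟨N, hN, hadd, hsub⟩ := hΔH.exists_posSemidef_smul_one_add_sub
  have hχ := isONB_single d
  set P := vecMulVec (φ k) (star (φ k)) with hP
  set Q := vecMulVec (Pi.single c 1 : Fin d → ℂ) (star (Pi.single c 1 : Fin d → ℂ)) with hQ
  have hD : 0 < N * d ^ 2 + 1 := by positivity
  set t : ℝ := (N * d ^ 2 + 1)⁻¹ with ht
  have ht0 : 0 < t := inv_pos.mpr hD
  have htN : t * (N * d ^ 2 + 1) = 1 := inv_mul_cancel₀ hD.ne'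
  clear_value t
  have hPQ : (P ⊗ₖ Q).PosSemidef :=
    (posSemidef_vecMulVec_self_star _).kronecker (posSemidef_vecMulVec_self_star _)
  have htr : (P ⊗ₖ Q).trace = 1 := by
    rw [trace_kronecker, hP, hQ, trace_vecMulVec, trace_vecMulVec, dotProduct_comm, hv,
      dotProduct_comm, hχ c c]
    simp
  have hcc : ∀ s : ℝ, (((N : ℂ) • (1 : Matrix (Fin d × Fin d) (Fin d × Fin d) ℂ) +
      (s : ℂ) • Δ).PosSemidef) → Commute ((N : ℂ) • sndBlock 1 b b' + (s : ℂ) • sndBlock Δ b b')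
        ((N : ℂ) • sndBlock 1 c c + P + (s : ℂ) • sndBlock Δ c c) := by
    intro s hs
    have heq : (t : ℂ) • ((N : ℂ) • (1 : Matrix (Fin d × Fin d) (Fin d × Fin d) ℂ) + P ⊗ₖ Q) +
        ((t * s : ℝ) : ℂ) • Δ = (t : ℂ) • (((N : ℂ) • 1 + (s : ℂ) • Δ) + P ⊗ₖ Q) := by
      push_cast
      module
    have hCC := h _ (t * s)
      (isCC_smul_one_add_kronecker hφ hχ k c hN ht0.le htN) (by
        rw [← hP, ← hQ, heq]
        refine ⟨(hs.add hPQ).smul (by exact_mod_cast ht0.le), ?_⟩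
        simp only [trace_smul, trace_add, htr, hΔtr, trace_one, Fintype.card_prod,
          Fintype.card_fin, smul_eq_mul, mul_zero, add_zero]
        exact_mod_cast (by linear_combination htN : t * (N * (d * d) + 1) = 1))
    rw [← hP, ← hQ, heq] at hCC
    have hcomm := hCC.commute_sndBlock b b' c c
    have ht0' : (t : ℂ) ≠ 0 := by exact_mod_cast ht0.ne'
    have e1 : sndBlock ((t : ℂ) • (((N : ℂ) • 1 + (s : ℂ) • Δ) + P ⊗ₖ Q)) b b' =
        (t : ℂ) • ((N : ℂ) • sndBlock 1 b b' + (s : ℂ) • sndBlock Δ b b') := by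
      ext a a'
      simp [sndBlock, hQ, vecMulVec_apply, Pi.single_apply, hc.symm]
    have e2 : sndBlock ((t : ℂ) • (((N : ℂ) • 1 + (s : ℂ) • Δ) + P ⊗ₖ Q)) c c =
        (t : ℂ) • ((N : ℂ) • sndBlock 1 c c + P + (s : ℂ) • sndBlock Δ c c) := by
      ext a a'
      simp only [sndBlock, hQ, Matrix.of_apply, Matrix.smul_apply, Matrix.add_apply,
        kronecker_apply, vecMulVec_apply, Pi.single_eq_same, Pi.star_apply, star_one, mul_one,
        smul_eq_mul]
      ring
    rw [e1, e2] at hcomm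
    rwa [Commute.smul_left_iff₀ ht0', Commute.smul_right_iff₀ ht0'] at hcomm
  have hone : ∀ e e' : Fin d, sndBlock 1 e e' = (if e = e' then (1 : ℂ) else 0) •
      (1 : Matrix (Fin d) (Fin d) ℂ) := by
    intro e e'
    ext a a'
    by_cases h1 : a = a' <;> by_cases h2 : e = e' <;> simp [sndBlock, Matrix.one_apply, h1, h2]
  have hplus := (hcc 1 (by simpa using hadd)).eq
  have hminus := (hcc (-1) (by simpa [← sub_eq_add_neg] using hsub)).eq
  rw [hone, hone] at hplus hminus
  set z : ℂ := if b = b' then 1 else 0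
  have hcomb : (2 : ℂ) • (sndBlock Δ b b' * P) = (2 : ℂ) • (P * sndBlock Δ b b') := by
    simp only [add_mul, mul_add, smul_mul_assoc, mul_smul_comm, one_mul, mul_one, if_true,
      Complex.ofReal_one, Complex.ofReal_neg] at hplus hminus
    linear_combination (norm := module) hplus - hminus
  exact smul_right_injective _ (two_ne_zero (α := ℂ)) hcomb

theorem stmt6 (d : ℕ) (hd : 2 ≤ d)
    (Δ : Matrix (Fin d × Fin d) (Fin d × Fin d) ℂ)
    (hΔ0 : Δ ≠ 0) (hΔH : Δ.IsHermitian) (hΔtr : Δ.trace = 0) :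
    ∃ (ρ : Matrix (Fin d × Fin d) (Fin d × Fin d) ℂ) (lam : ℝ),
      IsCC ρ ∧ IsState (ρ + (lam : ℂ) • Δ) ∧ ¬ IsCC (ρ + (lam : ℂ) • Δ) := by
  by_contra! hcon
  have hswap : ∀ M : Matrix (Fin d × Fin d) (Fin d × Fin d) ℂ,
      (M.submatrix Prod.swap Prod.swap).submatrix Prod.swap Prod.swap = M := by
    intro M
    ext ⟨a, b⟩ ⟨a', b'⟩
    rfl
  have hsnd := sndBlock_scalar_of_preserves_isCC hd hΔH hΔtr hcon
  have hfst := sndBlock_scalar_of_preserves_isCC (Δ := Δ.submatrix Prod.swap Prod.swap) hd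
    (hΔH.submatrix _)
    (by rw [← hΔtr]; exact Equiv.sum_comp (Equiv.prodComm (Fin d) (Fin d)) fun i => Δ i i)
    (fun ρ lam hρ hst => by
      have heq : (ρ + (lam : ℂ) • Δ.submatrix Prod.swap Prod.swap).submatrix Prod.swap Prod.swap =
          ρ.submatrix Prod.swap Prod.swap + (lam : ℂ) • Δ := by
        ext ⟨a, b⟩ ⟨a', b'⟩
        rfl
      have h := hcon _ lam hρ.submatrix_swap (heq ▸ hst.submatrix_swap)
      rw [← heq] at h
      simpa only [hswap] using h.submatrix_swap)
  simp only [Matrix.submatrix_apply, Prod.swap_prod_mk] at hfst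
  let i₀ : Fin d := ⟨0, by omega⟩
  have hscalar : Δ = Δ (i₀, i₀) (i₀, i₀) • (1 : Matrix (Fin d × Fin d) (Fin d × Fin d) ℂ) := by
    ext ⟨a, b⟩ ⟨a', b'⟩
    by_cases ha : a = a'
    · by_cases hb : b = b'
      · subst ha hb
        rw [(hsnd b b).2 a i₀, (hfst i₀ i₀).2 b i₀]
        simp
      · rw [(hfst a a').1 b b' hb]
        simp [hb]
    · rw [(hsnd b b').1 a a' ha]
      simp [ha]
  have hz : Δ (i₀, i₀) (i₀, i₀) = 0 := by
    have htr := hΔtr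
    rw [hscalar, trace_smul, trace_one] at htr
    simpa [show d ≠ 0 by omega] using htr
  exact hΔ0 (by rw [hscalar, hz, zero_smul])
end
end

section
/- Let d ≥ 2 and let (E_1, ..., E_n) be a POVM on C^d ⊗ C^d with the property that for every separable state ρ and every entangled state σ there exists an index j with tr(ρE_j) ≠ tr(σE_j). Then (E_1, ..., E_n) is informationally complete, i.e., any two states ρ, σ on C^d ⊗ C^d satisfying tr(ρE_j) = tr(σE_j) for all j are equal. -/
open Matrix
open Kronecker
open scoped ComplexOrder

noncomputable section

/-- Separable states: finite convex combinations `ρ = ∑ᵢ cᵢ σᵢ ⊗ ηᵢ` of product states. -/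
def IsSep {d : ℕ} (ρ : Matrix (Fin d × Fin d) (Fin d × Fin d) ℂ) : Prop :=
  ∃ (n : ℕ) (c : Fin n → ℝ) (σ η : Fin n → Matrix (Fin d) (Fin d) ℂ),
    (∀ i, 0 ≤ c i) ∧ ((∑ i, c i) = 1) ∧ (∀ i, IsState (σ i)) ∧ (∀ i, IsState (η i)) ∧
    ρ = ∑ i, (c i : ℂ) • (σ i ⊗ₖ η i)


/-- Partial transpose on the second tensor factor. -/
def partialTranspose {m : Type*} (M : Matrix (m × m) (m × m) ℂ) : Matrix (m × m) (m × m) ℂ :=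
  Matrix.of fun p q => M (p.1, q.2) (q.1, p.2)

lemma partialTranspose_add {m : Type*} (M N : Matrix (m × m) (m × m) ℂ) :
    partialTranspose (M + N) = partialTranspose M + partialTranspose N := rfl

lemma partialTranspose_smul {m : Type*} (c : ℂ) (M : Matrix (m × m) (m × m) ℂ) :
    partialTranspose (c • M) = c • partialTranspose M := rfl

lemma partialTranspose_sum {m κ : Type*} (s : Finset κ) (M : κ → Matrix (m × m) (m × m) ℂ) :
    partialTranspose (∑ k ∈ s, M k) = ∑ k ∈ s, partialTranspose (M k) := by
  ext p q
  simp [partialTranspose, Matrix.sum_apply]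

lemma partialTranspose_kronecker {m : Type*} (A B : Matrix m m ℂ) :
    partialTranspose (A ⊗ₖ B) = A ⊗ₖ Bᵀ := rfl

lemma partialTranspose_partialTranspose {m : Type*} (M : Matrix (m × m) (m × m) ℂ) :
    partialTranspose (partialTranspose M) = M := rfl

lemma isHermitian_partialTranspose {m : Type*} {M : Matrix (m × m) (m × m) ℂ}
    (hM : M.IsHermitian) : (partialTranspose M).IsHermitian := by
  ext p q
  exact hM.apply _ _

/-- The positive partial transpose criterion. -/
lemma IsSep.posSemidef_partialTranspose {d : ℕ} {ρ : Matrix (Fin d × Fin d) (Fin d × Fin d) ℂ}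
    (h : IsSep ρ) : (partialTranspose ρ).PosSemidef := by
  obtain ⟨n, c, σ, η, hc, -, hσ, hη, rfl⟩ := h
  rw [partialTranspose_sum]
  refine posSemidef_sum _ fun i _ => ?_
  rw [partialTranspose_smul, partialTranspose_kronecker]
  exact ((hσ i).1.kronecker (hη i).1.transpose).smul (by exact_mod_cast hc i)

lemma exists_isState_smul_eq {m : Type*} [Fintype m] [DecidableEq m] [Nonempty m]
    {A : Matrix m m ℂ} (hA : A.PosSemidef) :
    ∃ σ : Matrix m m ℂ, IsState σ ∧ A = (A.trace.re : ℂ) • σ := by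
  have htr : ((A.trace.re : ℝ) : ℂ) = A.trace :=
    (Complex.eq_re_of_ofReal_le (r := 0) (by exact_mod_cast hA.trace_nonneg)).symm
  rw [htr]
  by_cases h : A.trace = 0
  · obtain ⟨i⟩ := ‹Nonempty m›
    refine ⟨Matrix.diagonal (Pi.single i 1), ⟨PosSemidef.diagonal ?_, ?_⟩, ?_⟩
    · exact Pi.single_nonneg.2 zero_le_one
    · simp [Matrix.trace_diagonal]
    · rw [h, zero_smul, hA.trace_eq_zero_iff.1 h]
  · refine ⟨A.trace⁻¹ • A, ⟨hA.smul (inv_nonneg.2 hA.trace_nonneg), ?_⟩, ?_⟩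
    · rw [Matrix.trace_smul, smul_eq_mul, inv_mul_cancel₀ h]
    · rw [smul_smul, mul_inv_cancel₀ h, one_smul]

lemma isSep_smul_sum_kronecker {d : ℕ} {κ : Type*} [Fintype κ]
    (A B : κ → Matrix (Fin d) (Fin d) ℂ) (hA : ∀ k, (A k).PosSemidef)
    (hB : ∀ k, (B k).PosSemidef) {r : ℝ} (hr : 0 < r)
    (htr : (∑ k, A k ⊗ₖ B k).trace = r) :
    IsSep (((r⁻¹ : ℝ) : ℂ) • ∑ k, A k ⊗ₖ B k) := by
  have : Nonempty (Fin d) := by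
    by_contra hne
    rw [not_nonempty_iff] at hne
    have h0 : (r : ℂ) = 0 := by rw [← htr]; simp [Matrix.trace]
    exact hr.ne' (by exact_mod_cast h0)
  choose σ hσ hAσ using fun k => exists_isState_smul_eq (hA k)
  choose η hη hBη using fun k => exists_isState_smul_eq (hB k)
  have nonneg_re : ∀ {M : Matrix (Fin d) (Fin d) ℂ}, M.PosSemidef → 0 ≤ M.trace.re :=
    fun hM => (Complex.le_def.1 hM.trace_nonneg).1
  have hprod : ∀ k, A k ⊗ₖ B k =
      (((A k).trace.re * (B k).trace.re : ℝ) : ℂ) • (σ k ⊗ₖ η k) := fun k => by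
    conv_lhs => rw [hAσ k, hBη k]
    rw [smul_kronecker, kronecker_smul, smul_smul, Complex.ofReal_mul]
  have hsum : ∑ k, (A k).trace.re * (B k).trace.re = r := by
    have : ((∑ k, (A k).trace.re * (B k).trace.re : ℝ) : ℂ) = r := by
      rw [← htr, Matrix.trace_sum, Complex.ofReal_sum]
      refine Finset.sum_congr rfl fun k _ => ?_
      rw [hprod k, Matrix.trace_smul, Matrix.trace_kronecker, (hσ k).2, (hη k).2]
      simp
    exact_mod_cast this
  let e := (Fintype.equivFin κ).symm
  refine ⟨Fintype.card κ, fun i => r⁻¹ * ((A (e i)).trace.re * (B (e i)).trace.re),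
    σ ∘ e, η ∘ e, fun i => ?_, ?_, fun i => hσ _, fun i => hη _, ?_⟩
  · have := nonneg_re (hA (e i))
    have := nonneg_re (hB (e i))
    positivity
  · rw [← Finset.mul_sum, e.sum_comp (fun k => (A k).trace.re * (B k).trace.re), hsum,
      inv_mul_cancel₀ hr.ne']
  · rw [Finset.smul_sum, ← e.sum_comp]
    refine Finset.sum_congr rfl fun i _ => ?_
    rw [hprod, smul_smul]
    simp

open scoped MatrixOrder Matrix.Norms.L2Operator in
lemma Matrix.PosDef.exists_posSemidef_add_smul {m : Type*} [Fintype m] [DecidableEq m]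
    {A X : Matrix m m ℂ} (hA : A.PosDef) (hX : X.IsHermitian) :
    ∃ ε : ℝ, 0 < ε ∧ ∀ t : ℝ, |t| ≤ ε → (A + (t : ℂ) • X).PosSemidef := by
  cases isEmpty_or_nonempty m
  · exact ⟨1, one_pos, fun t _ => by rw [Subsingleton.elim (A + _) 0]; exact .zero⟩
  have hA' := hA.isStrictlyPositive
  obtain ⟨r, hr, hrA⟩ : ∃ r > 0, algebraMap ℝ (Matrix m m ℂ) r ≤ A :=
    (CFC.exists_pos_algebraMap_le_iff hA'.isSelfAdjoint).2 fun x hx => hA'.spectrum_pos hx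
  have hpos : 0 < ‖X‖ + 1 := by positivity
  refine ⟨r / (‖X‖ + 1), by positivity, fun t ht => ?_⟩
  have hsa : IsSelfAdjoint ((t : ℂ) • X) :=
    IsSelfAdjoint.smul (Complex.conj_ofReal t) hX
  have hnorm : ‖(t : ℂ) • X‖ ≤ r := by
    rw [norm_smul, Complex.norm_real, Real.norm_eq_abs]
    rw [le_div_iff₀ hpos] at ht
    nlinarith [abs_nonneg t]
  rw [← Matrix.nonneg_iff_posSemidef]
  calc (0 : Matrix m m ℂ) ≤ algebraMap ℝ _ r + -algebraMap ℝ _ ‖(t : ℂ) • X‖ := by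
        rw [← sub_eq_add_neg, sub_nonneg]
        exact algebraMap_mono _ hnorm
    _ ≤ A + (t : ℂ) • X := add_le_add hrA hsa.neg_algebraMap_norm_le_self

lemma exists_det_ne_zero_quadratic_ne_zero {d : ℕ}
    {Y : Matrix (Fin d × Fin d) (Fin d × Fin d) ℂ} (hY : Y.IsHermitian) (hY0 : Y ≠ 0) :
    ∃ Ψ : Matrix (Fin d) (Fin d) ℂ, Ψ.det ≠ 0 ∧
      star (fun p : Fin d × Fin d => Ψ p.1 p.2) ⬝ᵥ
        (Y *ᵥ fun p : Fin d × Fin d => Ψ p.1 p.2) ≠ 0 := by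
  by_contra! hcon
  have hall : ∀ Ψ : Matrix (Fin d) (Fin d) ℂ, star (fun p : Fin d × Fin d => Ψ p.1 p.2) ⬝ᵥ
      (Y *ᵥ fun p : Fin d × Fin d => Ψ p.1 p.2) = 0 := by
    intro Ψ
    let q : ℂ → ℂ := fun t =>
      star (fun p : Fin d × Fin d => (t • (1 : Matrix (Fin d) (Fin d) ℂ) + Ψ) p.1 p.2) ⬝ᵥ
        (Y *ᵥ fun p : Fin d × Fin d => (t • (1 : Matrix (Fin d) (Fin d) ℂ) + Ψ) p.1 p.2)
    have hq : Continuous q := by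
      simp only [q, dotProduct, mulVec, Matrix.add_apply, Matrix.smul_apply, Pi.star_apply]
      fun_prop
    have hdense : Dense {t : ℂ | (t • (1 : Matrix (Fin d) (Fin d) ℂ) + Ψ).det ≠ 0} := by
      have : {t : ℂ | (t • (1 : Matrix (Fin d) (Fin d) ℂ) + Ψ).det ≠ 0} =
          ((-Ψ).charpoly.rootSet ℂ)ᶜ := by
        ext t
        simp [Polynomial.mem_rootSet, (charpoly_monic (-Ψ)).ne_zero, eval_charpoly,
          Matrix.smul_one_eq_diagonal, Matrix.scalar_apply]
      rw [this]
      exact (Polynomial.rootSet_finite _ _).countable.dense_compl ℂ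
    have hzero : q = fun _ => 0 :=
      hq.ext_on hdense continuous_const fun t ht => hcon _ ht
    simpa [q] using congrFun hzero 0
  have hquad : ∀ x, star x ⬝ᵥ (Y *ᵥ x) = 0 := fun x => hall (Matrix.of fun i j => x (i, j))
  have hpos : Y.PosSemidef := .of_dotProduct_mulVec_nonneg hY fun x => (hquad x).ge
  have hneg : (-Y).PosSemidef := .of_dotProduct_mulVec_nonneg hY.neg fun x => by
    rw [neg_mulVec, dotProduct_neg, hquad, neg_zero]
  refine hY0 (hpos.trace_eq_zero_iff.1 (le_antisymm ?_ hpos.trace_nonneg))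
  simpa using hneg.trace_nonneg

/-- Pairs of orthogonal vectors whose tensor products span the whole space. -/
def orthogonalPair (d : ℕ) : Fin d × Fin d × Fin 3 → (Fin d → ℂ) × (Fin d → ℂ)
  | (i, j, s) =>
    if i = j then 0 else
    ![(Pi.single i 1, Pi.single j 1),
      (Pi.single i 1 + Pi.single j 1, Pi.single i 1 - Pi.single j 1),
      (Pi.single i 1 + Pi.single j Complex.I, Pi.single i 1 - Pi.single j Complex.I)] s

lemma orthogonalPair_orthogonal {d : ℕ} (k : Fin d × Fin d × Fin 3) :
    star (orthogonalPair d k).1 ⬝ᵥ (orthogonalPair d k).2 = 0 := by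
  obtain ⟨i, j, s⟩ := k
  by_cases h : i = j
  · simp [orthogonalPair, h]
  · have h' : j ≠ i := Ne.symm h
    fin_cases s <;> simp [orthogonalPair, h, h', dotProduct_sub, dotProduct_single]

lemma eq_zero_of_orthogonalPair {d : ℕ} (hd : 2 ≤ d) (Y : Matrix (Fin d) (Fin d) ℂ)
    (h : ∀ k, (orthogonalPair d k).1 ⬝ᵥ (Y *ᵥ (orthogonalPair d k).2) = 0) : Y = 0 := by
  have hoff : ∀ i j, i ≠ j → Y i j = 0 := fun i j hij => by
    simpa [orthogonalPair, hij] using h (i, j, 0)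
  have : Nontrivial (Fin d) := Fin.nontrivial_iff_two_le.2 hd
  ext i j
  by_cases hij : i = j
  · subst hij
    obtain ⟨j, hj⟩ := exists_ne i
    have h1 := h (i, j, 1)
    have h2 := h (i, j, 2)
    simp [orthogonalPair, hj.symm, Matrix.mulVec_sub, dotProduct_sub, add_dotProduct, hoff i j hj.symm,
      hoff j i hj] at h1 h2
    rw [Matrix.zero_apply]
    linear_combination (h1 + h2) / 2 + Y j j / 2 * Complex.I_mul_I
  · exact hoff i j hij

/-- Every maximal Schmidt rank vector is orthogonal, after partial transposition, to some
separable state of full rank. -/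
lemma exists_isSep_posDef_quadratic_eq_zero {d : ℕ} (hd : 2 ≤ d) {Ψ : Matrix (Fin d) (Fin d) ℂ}
    (hΨ : Ψ.det ≠ 0) :
    ∃ ρ : Matrix (Fin d × Fin d) (Fin d × Fin d) ℂ, IsSep ρ ∧ ρ.PosDef ∧ ρ.trace = 1 ∧
      star (fun p : Fin d × Fin d => Ψ p.1 p.2) ⬝ᵥ
        (partialTranspose ρ *ᵥ fun p : Fin d × Fin d => Ψ p.1 p.2) = 0 := by
  have : NeZero d := ⟨by omega⟩
  have hu : IsUnit Ψ.det := hΨ.isUnit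
  let a := fun k => (orthogonalPair d k).1
  let b := fun k => Ψ⁻¹ *ᵥ (orthogonalPair d k).2
  let A := fun k => vecMulVec (a k) (star (a k))
  let B := fun k => vecMulVec (b k) (star (b k))
  have hA : ∀ k, (A k).PosSemidef := fun k => posSemidef_vecMulVec_self_star _
  have hB : ∀ k, (B k).PosSemidef := fun k => posSemidef_vecMulVec_self_star _
  have hpd : (∑ k, A k ⊗ₖ B k).PosDef := by
    let V : Matrix (Fin d × Fin d) (Fin d × Fin d × Fin 3) ℂ :=
      Matrix.of fun p k => a k p.1 * b k p.2
    have hV : ∑ k, A k ⊗ₖ B k = V * Vᴴ := by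
      ext p q
      simp only [Matrix.sum_apply, mul_apply]
      refine Finset.sum_congr rfl fun k _ => ?_
      simp [A, B, V, vecMulVec_apply]
      ring
    rw [hV]
    refine PosDef.mul_conjTranspose_self V ?_
    refine (injective_iff_map_eq_zero (Matrix.vecMulLinear V)).2 fun y hy => ?_
    let Z : Matrix (Fin d) (Fin d) ℂ := Matrix.of fun i j => y (i, j)
    have hZ : Z * Ψ⁻¹ = 0 := by
      refine eq_zero_of_orthogonalPair hd _ fun k => ?_
      rw [← mulVec_mulVec]
      have := congrFun hy k
      change ∑ p : Fin d × Fin d, y p * (a k p.1 * b k p.2) = 0 at this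
      rw [Fintype.sum_prod_type] at this
      rw [← this]
      change ∑ i, a k i * ∑ j, Z i j * b k j = _
      simp only [Finset.mul_sum]
      refine Finset.sum_congr rfl fun i _ => Finset.sum_congr rfl fun j _ => ?_
      simp only [Z, of_apply]
      ring
    have hZ0 : Z = 0 := by
      rw [← Matrix.mul_one Z, ← Matrix.nonsing_inv_mul Ψ hu, ← Matrix.mul_assoc, hZ,
        Matrix.zero_mul]
    ext ⟨i, j⟩
    exact congrFun (congrFun hZ0 i) j
  have htr := hpd.trace_pos
  set R := ∑ k, A k ⊗ₖ B k with hR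
  have hre : R.trace = (R.trace.re : ℂ) :=
    Complex.eq_re_of_ofReal_le (r := 0) (by exact_mod_cast htr.le)
  have hr : 0 < R.trace.re := (Complex.lt_def.1 htr).1
  refine ⟨((R.trace.re⁻¹ : ℝ) : ℂ) • R, isSep_smul_sum_kronecker A B hA hB hr hre,
    hpd.smul (by exact_mod_cast inv_pos.2 hr), ?_, ?_⟩
  · rw [Matrix.trace_smul, hre, smul_eq_mul, Complex.ofReal_re, Complex.ofReal_inv,
      inv_mul_cancel₀ (by exact_mod_cast hr.ne')]
  · rw [partialTranspose_smul, hR, partialTranspose_sum, smul_mulVec, dotProduct_smul,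
      sum_mulVec, dotProduct_sum]
    refine smul_eq_zero_of_right _ (Finset.sum_eq_zero fun k _ => ?_)
    have hw : partialTranspose (A k ⊗ₖ B k) =
        vecMulVec (fun p : Fin d × Fin d => a k p.1 * star (b k p.2))
          (star fun p : Fin d × Fin d => a k p.1 * star (b k p.2)) := by
      ext p q
      simp [partialTranspose_kronecker, A, B, vecMulVec_apply]
      ring
    have horth : (star fun p : Fin d × Fin d => a k p.1 * star (b k p.2)) ⬝ᵥ
        (fun p : Fin d × Fin d => Ψ p.1 p.2) = 0 := by
      have hb : Ψ *ᵥ b k = (orthogonalPair d k).2 := by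
        rw [mulVec_mulVec, Matrix.mul_nonsing_inv Ψ hu, one_mulVec]
      have h0 := orthogonalPair_orthogonal k
      rw [← hb] at h0
      rw [← h0]
      simp only [dotProduct, mulVec, Fintype.sum_prod_type, Finset.mul_sum]
      refine Finset.sum_congr rfl fun i _ => Finset.sum_congr rfl fun j _ => ?_
      simp [a]
      ring
    rw [hw, vecMulVec_mulVec, horth]
    simp

theorem stmt10 (d n : ℕ) (hd : 2 ≤ d)
    (E : Fin n → Matrix (Fin d × Fin d) (Fin d × Fin d) ℂ)
    (hEpos : ∀ j, (E j).PosSemidef) (hEsum : (∑ j, E j) = 1)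
    (hdetect : ∀ ρ σ : Matrix (Fin d × Fin d) (Fin d × Fin d) ℂ,
      IsSep ρ → IsState σ → ¬ IsSep σ → ∃ j, (ρ * E j).trace ≠ (σ * E j).trace) :
    ∀ ρ σ : Matrix (Fin d × Fin d) (Fin d × Fin d) ℂ,
      IsState ρ → IsState σ → (∀ j, (ρ * E j).trace = (σ * E j).trace) → ρ = σ := by
  intro ρ σ hρ hσ heq
  by_contra hne
  set X := ρ - σ with hXdef
  have hX : X.IsHermitian := hρ.1.isHermitian.sub hσ.1.isHermitian
  have hXE : ∀ j, (X * E j).trace = 0 := fun j => by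
    rw [hXdef, Matrix.sub_mul, Matrix.trace_sub, heq, sub_self]
  have hXtr : X.trace = 0 := by rw [hXdef, Matrix.trace_sub, hρ.2, hσ.2, sub_self]
  have hY := isHermitian_partialTranspose hX
  have hY0 : partialTranspose X ≠ 0 := fun h => by
    refine hne (sub_eq_zero.1 ?_)
    rw [← hXdef, ← partialTranspose_partialTranspose X, h]
    rfl
  obtain ⟨Ψ, hΨ, hquad⟩ := exists_det_ne_zero_quadratic_ne_zero hY hY0
  obtain ⟨τ, hsep, hpd, hτtr, hτ⟩ := exists_isSep_posDef_quadratic_eq_zero hd hΨ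
  obtain ⟨ε, hε, hpert⟩ := hpd.exists_posSemidef_add_smul hX
  have hmem : ∀ t : ℝ, |t| ≤ ε → IsSep (τ + (t : ℂ) • X) := fun t ht => by
    by_contra hns
    obtain ⟨j, hj⟩ := hdetect τ _ hsep ⟨hpert t ht, by simp [hXtr, hτtr]⟩ hns
    exact hj (by simp [Matrix.add_mul, hXE])
  have hnonneg : ∀ t : ℝ, |t| ≤ ε → (0 : ℂ) ≤ t * (star (fun p : Fin d × Fin d => Ψ p.1 p.2) ⬝ᵥ
      (partialTranspose X *ᵥ fun p : Fin d × Fin d => Ψ p.1 p.2)) := fun t ht => by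
    have := (hmem t ht).posSemidef_partialTranspose.dotProduct_mulVec_nonneg
      (fun p : Fin d × Fin d => Ψ p.1 p.2)
    rwa [partialTranspose_add, partialTranspose_smul, add_mulVec, dotProduct_add, hτ, zero_add,
      smul_mulVec, dotProduct_smul, smul_eq_mul] at this
  have h1 := hnonneg ε (abs_of_pos hε).le
  have h2 := hnonneg (-ε) (by rw [abs_neg, abs_of_pos hε])
  rw [Complex.ofReal_neg, neg_mul, neg_nonneg] at h2
  have hεc : (ε : ℂ) ≠ 0 := by exact_mod_cast hε.ne'
  exact mul_ne_zero hεc hquad (le_antisymm h2 h1)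
end
end

section
/- Let d ≥ 2 and let (E_1, ..., E_n) be a POVM on C^d ⊗ C^d with the property that for every classical-quantum state ρ and every state σ that is not classical-quantum there exists an index j with tr(ρE_j) ≠ tr(σE_j). Then the real span of {E_1, ..., E_n} inside the real vector space of Hermitian matrices on C^d ⊗ C^d has dimension at least d^4 − d^2 + 1; in particular the POVM has at least d^4 − d^2 + 1 outcomes. -/
open Matrix
open Kronecker
open scoped ComplexOrder

noncomputable section

open scoped MatrixOrder Matrix.Norms.L2Operator in
/-- A positive definite matrix stays positive semidefinite under small Hermitian perturbations. -/
theorem Matrix.PosDef.exists_add_smul_posSemidef {m : Type*} [Fintype m] [DecidableEq m]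
    [Nonempty m] {P H : Matrix m m ℂ} (hP : P.PosDef) (hH : H.IsHermitian) :
    ∃ δ : ℝ, 0 < δ ∧ (P + δ • H).PosSemidef ∧ (P - δ • H).PosSemidef := by
  have hsp : IsStrictlyPositive P := Matrix.isStrictlyPositive_iff_posDef.2 hP
  have hsa : IsSelfAdjoint H := hH
  obtain ⟨r, hr, hrP⟩ :=
    (CFC.exists_pos_algebraMap_le_iff (a := P) hsp.isSelfAdjoint).2 fun x hx ↦ hsp.spectrum_pos hx
  have hc : 0 < ‖H‖ + 1 := by positivity
  have hδ : 0 < r / (‖H‖ + 1) := by positivity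
  have hle : r / (‖H‖ + 1) * ‖H‖ ≤ r := by
    rw [div_mul_eq_mul_div, div_le_iff₀ hc]
    nlinarith
  have hbound : (r / (‖H‖ + 1)) • algebraMap ℝ (Matrix m m ℂ) ‖H‖ ≤ P := by
    refine le_trans ?_ hrP
    rw [Algebra.smul_def, ← map_mul]
    exact algebraMap_mono _ hle
  refine ⟨r / (‖H‖ + 1), hδ, ?_, ?_⟩
  · rw [← Matrix.nonneg_iff_posSemidef]
    have h := smul_le_smul_of_nonneg_left hsa.neg_algebraMap_norm_le_self hδ.le
    rw [smul_neg] at h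
    have := add_le_add hbound h
    rwa [add_neg_cancel] at this
  · rw [← Matrix.nonneg_iff_posSemidef]
    have h := smul_le_smul_of_nonneg_left hsa.le_algebraMap_norm_self hδ.le
    exact sub_nonneg.2 (h.trans hbound)

/-- The operator on the first factor obtained by fixing a matrix entry on the second factor. -/
abbrev leftBlock {d : ℕ} (A : Matrix (Fin d × Fin d) (Fin d × Fin d) ℂ) (k l : Fin d) :
    Matrix (Fin d) (Fin d) ℂ :=
  A.submatrix (fun i ↦ (i, k)) (fun j ↦ (j, l))

theorem leftBlock_kronecker {d : ℕ} (D N : Matrix (Fin d) (Fin d) ℂ) (k l : Fin d) :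
    leftBlock (D ⊗ₖ N) k l = N k l • D := by
  ext i j
  simp [mul_comm]

theorem IsCQ.commute_leftBlock {d : ℕ} {A : Matrix (Fin d × Fin d) (Fin d × Fin d) ℂ}
    (hA : IsCQ A) (k l k' l' : Fin d) : Commute (leftBlock A k l) (leftBlock A k' l') := by
  obtain ⟨φ, c, η, hφ, -, -, -, rfl⟩ := hA
  have hblock : ∀ k l, leftBlock (∑ i, (c i : ℂ) • (vecMulVec (φ i) (star (φ i)) ⊗ₖ η i)) k l =
      ∑ i, (c i * η i k l) • vecMulVec (φ i) (star (φ i)) := by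
    intro k l
    ext a b
    simp only [submatrix_apply, Matrix.sum_apply, Matrix.smul_apply, kroneckerMap_apply,
      smul_eq_mul]
    exact Finset.sum_congr rfl fun i _ ↦ by ring
  rw [hblock, hblock]
  refine Commute.sum_left _ _ _ fun i _ ↦ Commute.sum_right _ _ _ fun j _ ↦ ?_
  refine (Commute.smul_right ?_ _).smul_left _
  rw [Commute, SemiconjBy, vecMulVec_mul_vecMulVec, vecMulVec_mul_vecMulVec, hφ, hφ]
  by_cases hij : i = j
  · subst hij; rfl
  · simp [hij, Ne.symm hij]

theorem Matrix.IsHermitian.exists_isONB_eq_sum {d : ℕ} {D : Matrix (Fin d) (Fin d) ℂ}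
    (hD : D.IsHermitian) : ∃ φ : Fin d → Fin d → ℂ, IsONB φ ∧
      D = ∑ i, (hD.eigenvalues i : ℂ) • vecMulVec (φ i) (star (φ i)) := by
  refine ⟨fun i ↦ hD.eigenvectorBasis i, fun i j ↦ ?_, ?_⟩
  · have := orthonormal_iff_ite.1 hD.eigenvectorBasis.orthonormal i j
    rwa [EuclideanSpace.inner_eq_star_dotProduct, dotProduct_comm] at this
  · conv_lhs => rw [hD.spectral_theorem, Unitary.conjStarAlgAut_apply]
    ext a b
    rw [Matrix.mul_apply]
    simp only [Matrix.mul_diagonal, Matrix.sum_apply, Matrix.smul_apply,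
      vecMulVec_apply, Matrix.star_apply, hD.eigenvectorUnitary_apply, Function.comp_apply,
      smul_eq_mul, Pi.star_apply]
    exact Finset.sum_congr rfl fun i _ ↦ by simp; ring

theorem isCQ_kronecker {d : ℕ} {D N : Matrix (Fin d) (Fin d) ℂ} (hD : IsState D)
    (hN : IsState N) : IsCQ (D ⊗ₖ N) := by
  obtain ⟨φ, hφ, hsum⟩ := hD.1.isHermitian.exists_isONB_eq_sum
  refine ⟨φ, hD.1.isHermitian.eigenvalues, fun _ ↦ N, hφ, hD.1.eigenvalues_nonneg, ?_,
    fun _ ↦ hN, ?_⟩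
  · have := hD.2.symm.trans hD.1.isHermitian.trace_eq_sum_eigenvalues
    exact Complex.ofReal_injective (by simpa using this.symm)
  · conv_lhs => rw [hsum]
    ext a b
    simp only [kroneckerMap_apply, Matrix.sum_apply, Matrix.smul_apply, Finset.sum_mul,
      smul_eq_mul, mul_assoc]

theorem Matrix.PosDef.isState_normalize {m : Type*} [Fintype m] [Nonempty m]
    {D : Matrix m m ℂ} (hD : D.PosDef) : IsState (D.trace⁻¹ • D) := by
  have ht : 0 < D.trace := hD.trace_pos
  refine ⟨hD.posSemidef.smul (inv_nonneg.2 ht.le), ?_⟩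
  rw [trace_smul, smul_eq_mul, inv_mul_cancel₀ ht.ne']

/-- If perturbing a classical-quantum state along a Hermitian `H` never leaves the
classical-quantum states, then the commutators of a positive definite matrix with the blocks of
`H` are proportional to the entries of any positive definite matrix. -/
theorem smul_commutator_leftBlock {d : ℕ} [NeZero d]
    {H : Matrix (Fin d × Fin d) (Fin d × Fin d) ℂ} (hH : H.IsHermitian)
    (hCQ : ∀ (ρ : Matrix (Fin d × Fin d) (Fin d × Fin d) ℂ) (t : ℝ),
      IsCQ ρ → ρ.trace = 1 → (ρ + t • H).PosSemidef → IsCQ (ρ + t • H))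
    {D N : Matrix (Fin d) (Fin d) ℂ} (hD : D.PosDef) (hN : N.PosDef) (k l k' l' : Fin d) :
    N k l • (D * leftBlock H k' l' - leftBlock H k' l' * D) =
      N k' l' • (D * leftBlock H k l - leftBlock H k l * D) := by
  have hDt : 0 < D.trace := hD.trace_pos
  have hNt : 0 < N.trace := hN.trace_pos
  have hDs := hD.isState_normalize
  have hNs := hN.isState_normalize
  have hDp : (D.trace⁻¹ • D).PosDef := hD.smul (inv_pos.2 hDt)
  have hNp : (N.trace⁻¹ • N).PosDef := hN.smul (inv_pos.2 hNt)
  obtain ⟨δ, hδ, hadd, hsub⟩ := (hDp.kronecker hNp).exists_add_smul_posSemidef hH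
  have htr : ((D.trace⁻¹ • D) ⊗ₖ (N.trace⁻¹ • N)).trace = 1 := by
    rw [trace_kronecker, hDs.2, hNs.2, one_mul]
  have h₁ := (hCQ _ δ (isCQ_kronecker hDs hNs) htr hadd).commute_leftBlock k l k' l'
  have h₂ := (hCQ _ (-δ) (isCQ_kronecker hDs hNs) htr
    (by rwa [neg_smul, ← sub_eq_add_neg])).commute_leftBlock k l k' l'
  have hblock : ∀ (t : ℝ) k l, leftBlock ((D.trace⁻¹ • D) ⊗ₖ (N.trace⁻¹ • N) + t • H) k l =
      (D.trace⁻¹ * N.trace⁻¹ * N k l) • D + (t : ℂ) • leftBlock H k l := by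
    intro t k l
    ext i j
    simp
    ring
  simp only [hblock, Commute, SemiconjBy, mul_add, add_mul, smul_mul_assoc, mul_smul_comm,
    Complex.ofReal_neg] at h₁ h₂
  have hδ' : (δ : ℂ) ≠ 0 := by exact_mod_cast hδ.ne'
  have hDt' := hDt.ne'
  have hNt' := hNt.ne'
  generalize D.trace = s at *
  generalize N.trace = t at *
  simp only [smul_sub]
  linear_combination (norm := skip) ((2 * δ)⁻¹ * s * t) • h₁ - ((2 * δ)⁻¹ * s * t) • h₂
  match_scalars <;> field_simp <;> ring

/-- A matrix commuting with all positive definite matrices is scalar. -/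
theorem mem_range_scalar_of_commute_posDef {m : Type*} [Fintype m] [DecidableEq m]
    {X : Matrix m m ℂ} (hX : ∀ D : Matrix m m ℂ, D.PosDef → Commute D X) :
    X ∈ Set.range (Matrix.scalar m) := by
  have hvec : ∀ v : m → ℂ, Commute (vecMulVec v (star v)) X := fun v ↦ by
    have h := (hX _ (PosDef.one.add_posSemidef (posSemidef_vecMulVec_self_star v))).sub_left
      (Commute.one_left X)
    rwa [add_sub_cancel_left] at h
  refine mem_range_scalar_iff_commute_single.2 fun i j hij ↦ ?_
  have h := ((hvec (Pi.single i 1)).mul_left (hvec (Pi.single i 1 + Pi.single j 1))).mul_left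
    (hvec (Pi.single j 1))
  have hsingle : vecMulVec (Pi.single i 1) (star (Pi.single i 1)) *
      vecMulVec (Pi.single i 1 + Pi.single j 1) (star (Pi.single i 1 + Pi.single j 1)) *
      vecMulVec (Pi.single j 1) (star (Pi.single j 1)) = single i j (1 : ℂ) := by
    simp [vecMulVec_mul_vecMulVec, single_eq_single_vecMulVec_single, hij.symm,
      Pi.star_single]
  rwa [hsingle] at h

theorem leftBlock_mem_range_scalar {d : ℕ} (hd : 2 ≤ d)
    {H : Matrix (Fin d × Fin d) (Fin d × Fin d) ℂ} (hH : H.IsHermitian)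
    (hCQ : ∀ (ρ : Matrix (Fin d × Fin d) (Fin d × Fin d) ℂ) (t : ℝ),
      IsCQ ρ → ρ.trace = 1 → (ρ + t • H).PosSemidef → IsCQ (ρ + t • H))
    (k l : Fin d) : leftBlock H k l ∈ Set.range (Matrix.scalar (Fin d)) := by
  have : NeZero d := ⟨by omega⟩
  have : Nontrivial (Fin d) := Fin.nontrivial_iff_two_le.2 hd
  refine mem_range_scalar_of_commute_posDef fun D hD ↦ sub_eq_zero.1 ?_
  by_cases hkl : k = l
  · subst hkl
    obtain ⟨k', hk'⟩ := exists_ne k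
    have h₁ := smul_commutator_leftBlock hH hCQ hD PosDef.one k k k' k'
    have h₂ := smul_commutator_leftBlock hH hCQ hD
      (PosDef.one.add_posSemidef (posSemidef_vecMulVec_self_star (Pi.single k 1))) k k k' k'
    simp [hk', vecMulVec_apply] at h₁ h₂
    rw [h₁] at h₂
    rwa [add_smul, one_smul, add_eq_left] at h₂
  · have h := smul_commutator_leftBlock hH hCQ hD PosDef.one k l k k
    simpa [hkl] using h.symm

theorem exists_eq_one_kronecker {d : ℕ} {H : Matrix (Fin d × Fin d) (Fin d × Fin d) ℂ}
    (hH : ∀ k l, leftBlock H k l ∈ Set.range (Matrix.scalar (Fin d))) :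
    ∃ X : Matrix (Fin d) (Fin d) ℂ, H = 1 ⊗ₖ X := by
  choose X hX using hH
  refine ⟨of X, ?_⟩
  ext ⟨i, k⟩ ⟨j, l⟩
  have h := congrFun (congrFun (hX k l) i) j
  simp only [submatrix_apply] at h
  rw [← h]
  simp [Matrix.one_apply, Matrix.diagonal_apply]

theorem finrank_ker_trace {d : ℕ} (hd : d ≠ 0) :
    Module.finrank ℂ (LinearMap.ker (traceLinearMap (Fin d) ℂ ℂ)) + 1 = d ^ 2 := by
  have : NeZero d := ⟨hd⟩
  have hsurj : Function.Surjective (traceLinearMap (Fin d) ℂ ℂ) := fun z ↦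
    ⟨single 0 0 z, by simp⟩
  have h := (traceLinearMap (Fin d) ℂ ℂ).finrank_range_add_finrank_ker
  rw [LinearMap.range_eq_top.2 hsurj, finrank_top, Module.finrank_self,
    Module.finrank_matrix] at h
  simp at h
  rw [pow_two]
  omega

/-- Extending scalars from `ℝ` to `ℂ` does not increase the dimension of a span. -/
theorem finrank_span_complex_le {V ι : Type*} [AddCommGroup V] [Module ℂ V] [Finite ι]
    (v : ι → V) : Module.finrank ℂ (Submodule.span ℂ (Set.range v)) ≤
      Module.finrank ℝ (Submodule.span ℝ (Set.range v)) := by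
  have : FiniteDimensional ℝ (Submodule.span ℝ (Set.range v)) :=
    FiniteDimensional.span_of_finite ℝ (Set.finite_range v)
  let b := Module.finBasis ℝ (Submodule.span ℝ (Set.range v))
  have hle : Submodule.span ℂ (Set.range v) ≤
      Submodule.span ℂ (Set.range fun i ↦ (b i : V)) := by
    refine Submodule.span_le.2 ?_
    rintro _ ⟨j, rfl⟩
    have h := congrArg Subtype.val
      (b.sum_repr ⟨v j, Submodule.subset_span (Set.mem_range_self j)⟩)
    simp only [Submodule.coe_sum, Submodule.coe_smul] at h
    rw [SetLike.mem_coe, ← h]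
    refine Submodule.sum_mem _ fun i _ ↦ ?_
    rw [← Complex.coe_smul]
    exact Submodule.smul_mem _ _ (Submodule.subset_span (Set.mem_range_self i))
  have : FiniteDimensional ℂ (Submodule.span ℂ (Set.range fun i ↦ (b i : V))) :=
    FiniteDimensional.span_of_finite ℂ (Set.finite_range _)
  refine (Submodule.finrank_mono hle).trans ?_
  simpa [Set.finrank] using finrank_range_le_card (R := ℂ) fun i ↦ (b i : V)

/-- The pairing `A ↦ (B ↦ tr (A B))` of matrices with a submodule of matrices. -/
def tracePairing {m : Type*} [Fintype m] (S : Submodule ℂ (Matrix m m ℂ)) :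
    Matrix m m ℂ →ₗ[ℂ] Module.Dual ℂ S :=
  S.subtype.dualMap ∘ₗ LinearMap.compr₂ (LinearMap.mul ℂ (Matrix m m ℂ)) (traceLinearMap m ℂ ℂ)

theorem exists_traceless_of_mem_ker {d n : ℕ} (hd : 2 ≤ d)
    {E : Fin n → Matrix (Fin d × Fin d) (Fin d × Fin d) ℂ}
    (hEpos : ∀ j, (E j).PosSemidef) (hEsum : (∑ j, E j) = 1)
    (hdetect : ∀ ρ σ : Matrix (Fin d × Fin d) (Fin d × Fin d) ℂ,
      IsCQ ρ → IsState σ → ¬ IsCQ σ → ∃ j, (ρ * E j).trace ≠ (σ * E j).trace)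
    {A : Matrix (Fin d × Fin d) (Fin d × Fin d) ℂ} (hA : ∀ j, (A * E j).trace = 0) :
    ∃ X : Matrix (Fin d) (Fin d) ℂ, X.trace = 0 ∧ A = 1 ⊗ₖ X := by
  have htrace : ∀ H : Matrix (Fin d × Fin d) (Fin d × Fin d) ℂ,
      (∀ j, (H * E j).trace = 0) → H.trace = 0 := fun H h ↦ by
    rw [← mul_one H, ← hEsum, Finset.mul_sum, trace_sum]
    exact Finset.sum_eq_zero fun j _ ↦ h j
  have hherm : ∀ H : Matrix (Fin d × Fin d) (Fin d × Fin d) ℂ, H.IsHermitian →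
      (∀ j, (H * E j).trace = 0) → ∃ X : Matrix (Fin d) (Fin d) ℂ, H = 1 ⊗ₖ X := by
    intro H hH h0
    refine exists_eq_one_kronecker (leftBlock_mem_range_scalar hd hH fun ρ t hρ htr hpos ↦ ?_)
    by_contra hσ
    obtain ⟨j, hj⟩ := hdetect ρ _ hρ ⟨hpos, by simp [htr, htrace H h0]⟩ hσ
    exact hj (by simp [add_mul, h0 j])
  have hstar : ∀ j, (Aᴴ * E j).trace = 0 := fun j ↦ by
    rw [trace_mul_comm, ← (hEpos j).isHermitian.eq, ← conjTranspose_mul, trace_conjTranspose,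
      hA j, star_zero]
  obtain ⟨X, hX⟩ := hherm (A + Aᴴ) (by simp [IsHermitian, add_comm])
    fun j ↦ by simp [add_mul, hA j, hstar j]
  obtain ⟨Y, hY⟩ := hherm (Complex.I • (A - Aᴴ)) (by simp [IsHermitian, sub_eq_add_neg, add_comm])
    fun j ↦ by simp [sub_mul, hA j, hstar j]
  have hAX : A = 1 ⊗ₖ ((2 : ℂ)⁻¹ • X - (2⁻¹ * Complex.I) • Y) := by
    rw [sub_eq_add_neg, kronecker_add, ← neg_smul, kronecker_smul, kronecker_smul, ← hX, ← hY,
      smul_smul, neg_mul, mul_assoc, Complex.I_mul_I]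
    module
  refine ⟨_, ?_, hAX⟩
  have h := htrace A hA
  rw [hAX, trace_kronecker, trace_one, Fintype.card_fin] at h
  exact (mul_eq_zero.1 h).resolve_left (by exact_mod_cast (by omega : d ≠ 0))

theorem stmt14 (d n : ℕ) (hd : 2 ≤ d)
    (E : Fin n → Matrix (Fin d × Fin d) (Fin d × Fin d) ℂ)
    (hEpos : ∀ j, (E j).PosSemidef) (hEsum : (∑ j, E j) = 1)
    (hdetect : ∀ ρ σ : Matrix (Fin d × Fin d) (Fin d × Fin d) ℂ,
      IsCQ ρ → IsState σ → ¬ IsCQ σ → ∃ j, (ρ * E j).trace ≠ (σ * E j).trace) :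
    d ^ 4 - d ^ 2 + 1 ≤ Module.finrank ℝ ↥(Submodule.span ℝ (Set.range E)) ∧
      d ^ 4 - d ^ 2 + 1 ≤ n := by
  have hspan : d ^ 4 - d ^ 2 + 1 ≤ Module.finrank ℝ (Submodule.span ℝ (Set.range E)) := by
    let S := Submodule.span ℂ (Set.range E)
    have hker : LinearMap.ker (tracePairing S) ≤ (LinearMap.ker (traceLinearMap (Fin d) ℂ ℂ)).map
        (kroneckerBilinear (R := ℂ) (1 : Matrix (Fin d) (Fin d) ℂ)) := by
      intro A hA
      have hAE : ∀ j, (A * E j).trace = 0 := fun j ↦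
        congrArg (fun f ↦ f ⟨E j, Submodule.subset_span (Set.mem_range_self j)⟩) hA
      obtain ⟨X, hX, hAX⟩ := exists_traceless_of_mem_ker hd hEpos hEsum hdetect hAE
      exact ⟨X, hX, hAX.symm⟩
    have hker_le := (Submodule.finrank_mono hker).trans (Submodule.finrank_map_le _ _)
    have htr := finrank_ker_trace (d := d) (by omega)
    have hrank := (tracePairing S).finrank_range_add_finrank_ker
    have hrange := (tracePairing S).range.finrank_le
    rw [Subspace.dual_finrank_eq] at hrange
    have hmat : Module.finrank ℂ (Matrix (Fin d × Fin d) (Fin d × Fin d) ℂ) = d ^ 4 := by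
      rw [Module.finrank_matrix]
      simp
      ring
    have hle : Module.finrank ℂ S ≤ _ := finrank_span_complex_le E
    have hpow : d ^ 2 ≤ d ^ 4 := Nat.pow_le_pow_right (by omega) (by omega)
    omega
  exact ⟨hspan, hspan.trans (by simpa [Set.finrank] using finrank_range_le_card (R := ℝ) E)⟩
end
end
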